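/- arXiv:2206.11209 — 6 statements merged into one kernel-verified Lean document; each statement's English description precedes it below -/
import Mathlib

section
/- Let n ≥ 1 and let H₁, …, Hₙ be complex Hilbert spaces, and let H be their Hilbert (l²-)direct sum, so that ‖(U₁,…,Uₙ)‖² = Σᵢ ‖Uᵢ‖². For each j let D_j be a linear subspace of H_j, and for each pair (i,j) with 1 ≤ i,j ≤ n let A_{ij} : D_j → H_i be a linear map. Assume that for every (i,j) with i ≠ j there exist N_{ij} ≥ 1, exponents p^{ij}_k ∈ [0,1] and constants b^{ij}_k ≥ 0 (1 ≤ k ≤ N_{ij}) such that ‖A_{ij} u‖ ≤ Σ_{k=1}^{N_{ij}} b^{ij}_k ‖A_{jj} u‖^{p^{ij}_k} ‖u‖^{1−p^{ij}_k} for all u ∈ D_j. Define, for U = (U₁,…,Uₙ) with U_j ∈ D_j for all j, the diagonal part 𝔇U = (A₁₁U₁, …, A_{nn}Uₙ) and the off-diagonal part ℛU by (ℛU)_i = Σ_{j ≠ i} A_{ij} U_j. Then for every such U one has ‖ℛU‖ ≤ Σ_{(i,j): i≠j} Σ_{k=1}^{N_{ij}} b^{ij}_k ‖𝔇U‖^{p^{ij}_k}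 ‖U‖^{1−p^{ij}_k}, where all norms on n-tuples are the l²-direct-sum norm. -/
open scoped BigOperators

/-- The `ℓ²` norm of a finite family is at most its `ℓ¹` norm. -/
theorem PiLp.norm_two_le_sum_norm {ι : Type*} [Fintype ι] {E : ι → Type*}
    [∀ i, NormedAddCommGroup (E i)] (x : PiLp 2 E) : ‖x‖ ≤ ∑ i, ‖x i‖ := by
  refine (sq_le_sq₀ (norm_nonneg x) ?_).mp ?_
  · exact Finset.sum_nonneg fun i _ => norm_nonneg (x i)
  · rw [PiLp.norm_sq_eq_of_L2]
    exact Finset.sum_sq_le_sq_sum_of_nonneg fun i _ => norm_nonneg (x i)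

/-- Lemma 2.3(i): if an `n × n` block operator matrix is diagonally generalized
subordinate, then its off-diagonal part `ℛ` is generalized subordinate to its
diagonal part `𝔇`, with constants obtained by concatenating those of all entries. -/
theorem offdiag_generalized_subordinate_of_diagonally_generalized_subordinate
    {n : ℕ} (hn : 1 ≤ n) (H : Fin n → Type*)
    [∀ i, NormedAddCommGroup (H i)] [∀ i, InnerProductSpace ℂ (H i)]
    (D : ∀ j, Submodule ℂ (H j))
    (A : ∀ i j, D j →ₗ[ℂ] H i)
    (N : Fin n → Fin n → ℕ)
    (p b : ∀ i j : Fin n, Fin (N i j) → ℝ)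
    (hN : ∀ i j, i ≠ j → 1 ≤ N i j)
    (hp : ∀ i j, i ≠ j → ∀ k, p i j k ∈ Set.Icc (0 : ℝ) 1)
    (hb : ∀ i j, i ≠ j → ∀ k, 0 ≤ b i j k)
    (hsub : ∀ i j, i ≠ j → ∀ u : D j,
      ‖A i j u‖ ≤ ∑ k, b i j k * ‖A j j u‖ ^ (p i j k) * ‖(u : H j)‖ ^ (1 - p i j k))
    (U : ∀ j, D j) :
    ‖(WithLp.equiv 2 (∀ i, H i)).symm
        (fun i => ∑ j ∈ Finset.univ.erase i, A i j (U j))‖ ≤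
      ∑ i : Fin n, ∑ j ∈ Finset.univ.erase i, ∑ k,
        b i j k *
          ‖(WithLp.equiv 2 (∀ i, H i)).symm (fun j => A j j (U j))‖ ^ (p i j k) *
            ‖(WithLp.equiv 2 (∀ i, H i)).symm (fun j => (U j : H j))‖ ^ (1 - p i j k) := by
  refine (PiLp.norm_two_le_sum_norm _).trans (Finset.sum_le_sum fun i _ => ?_)
  refine (norm_sum_le (Finset.univ.erase i) fun j => A i j (U j)).trans
    (Finset.sum_le_sum fun j hj => ?_)
  have hij : i ≠ j := (Finset.ne_of_mem_erase hj).symm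
  refine (hsub i j hij (U j)).trans (Finset.sum_le_sum fun k _ => ?_)
  obtain ⟨hp₀, hp₁⟩ := hp i j hij k
  have hA := PiLp.norm_apply_le
    ((WithLp.equiv 2 (∀ i, H i)).symm fun j => A j j (U j)) j
  have hU := PiLp.norm_apply_le
    ((WithLp.equiv 2 (∀ i, H i)).symm fun j => (U j : H j)) j
  have hq : 0 ≤ 1 - p i j k := sub_nonneg.mpr hp₁
  have hbk := hb i j hij k
  exact mul_le_mul
    (mul_le_mul_of_nonneg_left (Real.rpow_le_rpow (norm_nonneg _) hA hp₀) hbk)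
    (Real.rpow_le_rpow (norm_nonneg _) hU hq) (by positivity) (by positivity)
end

section
/- Let a : ℕ → ℂ be a sequence such that Σ_{k≥1} ((k−2)(k−1)k)² |a_k|² < ∞ and Σ_{k≥1} |a_k|² < ∞. Then Σ_{k≥1} k⁶ |a_k|² < ∞ and (Σ_{k≥1} k⁶ |a_k|²)^{1/2} ≤ 5 (Σ_{k≥1} ((k−2)(k−1)k)² |a_k|²)^{1/2} + √65 (Σ_{k≥1} |a_k|²)^{1/2}. -/
/-- The pointwise inequality `m⁶ ≤ 25 ((m-2)(m-1)m)² + 65` for integers `m = k + 1 ≥ 1`. -/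
lemma succ_pow_six_le (k : ℕ) :
    ((k : ℝ) + 1) ^ 6 ≤
      25 * ((((k : ℝ) + 1) - 2) * (((k : ℝ) + 1) - 1) * ((k : ℝ) + 1)) ^ 2 + 65 := by
  obtain hk | hk := lt_or_ge k 2
  · interval_cases k <;> norm_num
  · have hk' : (2 : ℝ) ≤ k := by exact_mod_cast hk
    have hsq : ((k : ℝ) + 1) ^ 2 ≤ 5 * ((((k : ℝ) + 1) - 2) * (((k : ℝ) + 1) - 1)) := by
      nlinarith
    have hcube : ((k : ℝ) + 1) ^ 3 ≤
        5 * ((((k : ℝ) + 1) - 2) * (((k : ℝ) + 1) - 1) * ((k : ℝ) + 1)) := by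
      nlinarith
    have hpow := pow_le_pow_left₀ (by positivity) hcube 2
    nlinarith

/-- Subadditivity of the square root on the nonnegative reals. -/
lemma sqrt_add_le_sqrt_add_sqrt {x y : ℝ} (hx : 0 ≤ x) (hy : 0 ≤ y) : √(x + y) ≤ √x + √y := by
  rw [Real.sqrt_le_left (by positivity), add_sq, Real.sq_sqrt hx, Real.sq_sqrt hy]
  nlinarith [mul_nonneg (Real.sqrt_nonneg x) (Real.sqrt_nonneg y)]

/-- Lemma 3.2(i): `‖H₀³φ‖ ≤ 5‖Gφ‖ + √65‖φ‖`, expressed in terms of the coefficient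
sequence `a k = ⟨φ, e k⟩` of `φ` in the Bargmann space basis, where
`(Gφ)_k = (k-2)(k-1)k·a_k` and `(H₀³φ)_k = k³·a_k`. -/
theorem coeff_H0_cubed_le (a : ℕ → ℂ)
    (hg : Summable fun k : ℕ =>
      ((((k : ℝ) + 1) - 2) * (((k : ℝ) + 1) - 1) * ((k : ℝ) + 1)) ^ 2 * ‖a (k + 1)‖ ^ 2)
    (hf : Summable fun k : ℕ => ‖a (k + 1)‖ ^ 2) :
    (Summable fun k : ℕ => ((k : ℝ) + 1) ^ 6 * ‖a (k + 1)‖ ^ 2) ∧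
      Real.sqrt (∑' k : ℕ, ((k : ℝ) + 1) ^ 6 * ‖a (k + 1)‖ ^ 2) ≤
        5 * Real.sqrt (∑' k : ℕ,
            ((((k : ℝ) + 1) - 2) * (((k : ℝ) + 1) - 1) * ((k : ℝ) + 1)) ^ 2 * ‖a (k + 1)‖ ^ 2)
          + Real.sqrt 65 * Real.sqrt (∑' k : ℕ, ‖a (k + 1)‖ ^ 2) := by
  have hg' := hg.mul_left 25
  have hf' := hf.mul_left 65
  have hle (k : ℕ) : ((k : ℝ) + 1) ^ 6 * ‖a (k + 1)‖ ^ 2 ≤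
      25 * (((((k : ℝ) + 1) - 2) * (((k : ℝ) + 1) - 1) * ((k : ℝ) + 1)) ^ 2 * ‖a (k + 1)‖ ^ 2)
        + 65 * ‖a (k + 1)‖ ^ 2 := by
    rw [← mul_assoc, ← add_mul]
    gcongr
    exact succ_pow_six_le k
  have hsum : Summable fun k : ℕ => ((k : ℝ) + 1) ^ 6 * ‖a (k + 1)‖ ^ 2 :=
    (hg'.add hf').of_nonneg_of_le (fun k => by positivity) hle
  refine ⟨hsum, ?_⟩
  have htsum := hsum.tsum_le_tsum hle (hg'.add hf')
  rw [hg'.tsum_add hf', tsum_mul_left, tsum_mul_left] at htsum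
  refine (Real.sqrt_le_sqrt htsum).trans ((sqrt_add_le_sqrt_add_sqrt ?_ ?_).trans_eq ?_)
  · positivity
  · positivity
  · rw [Real.sqrt_mul (by norm_num), Real.sqrt_mul (by norm_num),
      show (25 : ℝ) = 5 ^ 2 by norm_num, Real.sqrt_sq (by norm_num)]
end

section
/- Let a : ℕ → ℂ be a sequence with a₀ = 0 and Σ_{k≥1} k³ |a_k|² < ∞, and define c_m = (m−1)√m · a_{m−1} + m√(m+1) · a_{m+1} for m ≥ 1. Then (Σ_{m≥1} |c_m|²)^{1/2} ≤ (1 + 2√2) (Σ_{k≥1} k³ |a_k|²)^{1/2}. -/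
/-- Pointwise bound for the sum of a weighted left neighbour and a weighted right neighbour. -/
lemma norm_sq_neighbour_sum_le (m : ℕ) (x y : ℂ) :
    ‖(((m : ℝ) * Real.sqrt ((m : ℝ) + 1) : ℝ) : ℂ) * x
        + ((((m : ℝ) + 1) * Real.sqrt ((m : ℝ) + 2) : ℝ) : ℂ) * y‖ ^ 2
      ≤ 4 * ((m : ℝ) ^ 3 * ‖x‖ ^ 2) + 2 * (((m : ℝ) + 2) ^ 3 * ‖y‖ ^ 2) := by
  have hm : (0 : ℝ) ≤ m := m.cast_nonneg
  have hleft : (m : ℝ) ^ 2 * (m + 1) ≤ 2 * (m : ℝ) ^ 3 := by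
    rcases Nat.eq_zero_or_pos m with rfl | h
    · simp
    · have h1 : (1 : ℝ) ≤ m := by exact_mod_cast h
      nlinarith [mul_nonneg (sq_nonneg (m : ℝ)) (sub_nonneg.2 h1)]
  have hright : ((m : ℝ) + 1) ^ 2 * (m + 2) ≤ ((m : ℝ) + 2) ^ 3 := by
    nlinarith [mul_nonneg hm hm]
  set u := (((m : ℝ) * Real.sqrt ((m : ℝ) + 1) : ℝ) : ℂ) * x with hu
  set v := ((((m : ℝ) + 1) * Real.sqrt ((m : ℝ) + 2) : ℝ) : ℂ) * y with hv
  have hu2 : ‖u‖ ^ 2 = (m : ℝ) ^ 2 * (m + 1) * ‖x‖ ^ 2 := by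
    rw [hu, norm_mul, Complex.norm_real, Real.norm_eq_abs, mul_pow, sq_abs, mul_pow,
      Real.sq_sqrt (by positivity)]
  have hv2 : ‖v‖ ^ 2 = ((m : ℝ) + 1) ^ 2 * (m + 2) * ‖y‖ ^ 2 := by
    rw [hv, norm_mul, Complex.norm_real, Real.norm_eq_abs, mul_pow, sq_abs, mul_pow,
      Real.sq_sqrt (by positivity)]
  have huv : ‖u + v‖ ^ 2 ≤ (‖u‖ + ‖v‖) ^ 2 := by
    gcongr
    exact norm_add_le u v
  have hx := mul_le_mul_of_nonneg_right hleft (sq_nonneg ‖x‖)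
  have hy := mul_le_mul_of_nonneg_right hright (sq_nonneg ‖y‖)
  rw [← hu2] at hx
  rw [← hv2] at hy
  linarith [add_sq_le (a := ‖u‖) (b := ‖v‖)]

/-- First inequality of Lemma 3.2(iv): `‖H₁φ‖ ≤ (1 + 2√2) ‖H₀^{3/2}φ‖`,
expressed in terms of the coefficient sequence `a k = ⟨φ, e k⟩`, where
`(H₁φ)_m = (m-1)√m·a_{m-1} + m√(m+1)·a_{m+1}`. -/
theorem coeff_H1_le (a : ℕ → ℂ) (c : ℕ → ℂ) (ha0 : a 0 = 0)
    (hsum : Summable fun k : ℕ => ((k : ℝ) + 1) ^ 3 * ‖a (k + 1)‖ ^ 2)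
    (hc : ∀ m : ℕ, 1 ≤ m →
      c m = ((((m : ℝ) - 1) * Real.sqrt (m : ℝ) : ℝ) : ℂ) * a (m - 1)
          + (((m : ℝ) * Real.sqrt ((m : ℝ) + 1) : ℝ) : ℂ) * a (m + 1)) :
    (Summable fun m : ℕ => ‖c (m + 1)‖ ^ 2) ∧
      Real.sqrt (∑' m : ℕ, ‖c (m + 1)‖ ^ 2) ≤
        (1 + 2 * Real.sqrt 2) *
          Real.sqrt (∑' k : ℕ, ((k : ℝ) + 1) ^ 3 * ‖a (k + 1)‖ ^ 2) := by
  have hbound (m : ℕ) : ‖c (m + 1)‖ ^ 2 ≤ 4 * ((m : ℝ) ^ 3 * ‖a m‖ ^ 2)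
      + 2 * (((m : ℝ) + 2) ^ 3 * ‖a (m + 2)‖ ^ 2) := by
    refine le_trans (le_of_eq ?_) (norm_sq_neighbour_sum_le m (a m) (a (m + 2)))
    rw [hc (m + 1) (Nat.le_add_left 1 m)]
    have h2 : ((m : ℝ) + 1) + 1 = (m : ℝ) + 2 := by ring
    rw [Nat.add_sub_cancel, Nat.cast_add_one, add_sub_cancel_right, h2]
  have hleft : Summable fun m : ℕ => (m : ℝ) ^ 3 * ‖a m‖ ^ 2 := by
    rw [← summable_nat_add_iff 1]
    simpa using hsum
  have hleft_tsum : ∑' m : ℕ, (m : ℝ) ^ 3 * ‖a m‖ ^ 2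
      = ∑' k : ℕ, ((k : ℝ) + 1) ^ 3 * ‖a (k + 1)‖ ^ 2 := by
    rw [hleft.tsum_eq_zero_add]
    simp [ha0]
  have hshift : (fun m : ℕ => ((m : ℝ) + 2) ^ 3 * ‖a (m + 2)‖ ^ 2)
      = fun m : ℕ => (((m + 1 : ℕ) : ℝ) + 1) ^ 3 * ‖a (m + 1 + 1)‖ ^ 2 := by
    funext m
    push_cast
    ring_nf
  have hright : Summable fun m : ℕ => ((m : ℝ) + 2) ^ 3 * ‖a (m + 2)‖ ^ 2 := by
    rw [hshift]
    exact (summable_nat_add_iff 1).2 hsum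
  have hright_tsum : ∑' m : ℕ, ((m : ℝ) + 2) ^ 3 * ‖a (m + 2)‖ ^ 2
      ≤ ∑' k : ℕ, ((k : ℝ) + 1) ^ 3 * ‖a (k + 1)‖ ^ 2 := by
    rw [hsum.tsum_eq_zero_add, hshift]
    exact le_add_of_nonneg_left (by positivity)
  have hmajor := (hleft.mul_left 4).add (hright.mul_left 2)
  have hcsum : Summable fun m : ℕ => ‖c (m + 1)‖ ^ 2 :=
    Summable.of_nonneg_of_le (fun _ => sq_nonneg _) hbound hmajor
  refine ⟨hcsum, ?_⟩
  have htsum := hcsum.tsum_le_tsum hbound hmajor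
  rw [(hleft.mul_left 4).tsum_add (hright.mul_left 2), tsum_mul_left, tsum_mul_left,
    hleft_tsum] at htsum
  set S := ∑' k : ℕ, ((k : ℝ) + 1) ^ 3 * ‖a (k + 1)‖ ^ 2 with hS
  have hS0 : 0 ≤ S := tsum_nonneg fun k => by positivity
  have hconst : (6 : ℝ) ≤ (1 + 2 * Real.sqrt 2) ^ 2 := by
    nlinarith [Real.sqrt_nonneg 2, Real.sq_sqrt (zero_le_two (α := ℝ))]
  refine Real.sqrt_le_iff.2 ⟨by positivity, ?_⟩
  rw [mul_pow, Real.sq_sqrt hS0]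
  linarith [mul_le_mul_of_nonneg_right hconst hS0]
end

section
/- Let a : ℕ → ℂ be a sequence with a₀ = 0, Σ_{k≥1} ((k−2)(k−1)k)² |a_k|² < ∞ and Σ_{k≥1} |a_k|² < ∞, and define c_m = (m−1)√m · a_{m−1} + m√(m+1) · a_{m+1} for m ≥ 1. Write g = (Σ_{k≥1} ((k−2)(k−1)k)² |a_k|²)^{1/2} and f = (Σ_{k≥1} |a_k|²)^{1/2}. Then (Σ_{m≥1} |c_m|²)^{1/2} ≤ (1 + 2√2)√5 · g^{1/2} f^{1/2} + (1 + 2√2)·65^{1/4} · f. -/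
/-- Cauchy–Schwarz for the weighted sum `∑ w k * b k ^ 2`. -/
theorem summable_and_tsum_weight_mul_sq_le {w b : ℕ → ℝ} (hw : ∀ k, 0 ≤ w k) (hb : ∀ k, 0 ≤ b k)
    (hg : Summable fun k => w k ^ 2 * b k ^ 2) (hf : Summable fun k => b k ^ 2) :
    (Summable fun k => w k * b k ^ 2) ∧
      ∑' k, w k * b k ^ 2 ≤ √(∑' k, w k ^ 2 * b k ^ 2) * √(∑' k, b k ^ 2) := by
  have h := Real.summable_and_inner_le_Lp_mul_Lq_tsum_of_nonneg (f := fun k => w k * b k) (g := b)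
    Real.HolderConjugate.two_two (fun k => mul_nonneg (hw k) (hb k)) hb
    (by simpa [mul_pow] using hg) (by simpa using hf)
  simpa [Real.sqrt_eq_rpow, sq, mul_assoc, mul_left_comm] using h

/-- Summing `(u m + v (m + 1)) ^ 2`, where `u` and `v` vanish at `0`, after reindexing. -/
theorem summable_and_tsum_sq_le_of_le_shift {x u v : ℕ → ℝ} (hx : ∀ m, 0 ≤ x m)
    (hu0 : u 0 = 0) (hv0 : v 0 = 0) (hxuv : ∀ m, x m ≤ u m + v (m + 1))
    (hu : Summable fun m => u (m + 1) ^ 2) (hv : Summable fun m => v m ^ 2) :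
    (Summable fun m => x m ^ 2) ∧
      ∑' m, x m ^ 2 ≤ 2 * (∑' m, u (m + 1) ^ 2 + ∑' m, v m ^ 2) := by
  have hu' : Summable fun m => u m ^ 2 := (summable_nat_add_iff (f := fun m => u m ^ 2) 1).1 hu
  have hv' : Summable fun m => v (m + 1) ^ 2 :=
    (summable_nat_add_iff (f := fun m => v m ^ 2) 1).2 hv
  have hle : ∀ m, x m ^ 2 ≤ 2 * (u m ^ 2 + v (m + 1) ^ 2) := fun m =>
    (pow_le_pow_left₀ (hx m) (hxuv m) 2).trans add_sq_le
  have hs : Summable fun m => 2 * (u m ^ 2 + v (m + 1) ^ 2) := (hu'.add hv').mul_left 2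
  have hsum := Summable.of_nonneg_of_le (fun m => sq_nonneg (x m)) hle hs
  refine ⟨hsum, (hsum.tsum_le_tsum hle hs).trans_eq ?_⟩
  rw [tsum_mul_left, hu'.tsum_add hv', hu'.tsum_eq_zero_add, hv.tsum_eq_zero_add]
  simp [hu0, hv0]

/-- The two weights of `H₁` are dominated by the weight of `G` and a constant. -/
theorem gribov_weight_le (k : ℕ) :
    2 * (((k : ℝ) + 1) ^ 2 * ((k : ℝ) + 2) + (k : ℝ) ^ 2 * ((k : ℝ) + 1)) ≤
      70 * ((((k : ℝ) + 1) - 2) * (((k : ℝ) + 1) - 1) * ((k : ℝ) + 1)) + 112 := by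
  have hk : (0 : ℝ) ≤ k := k.cast_nonneg
  nlinarith [mul_nonneg hk (sq_nonneg ((k : ℝ) - 7 / 10)), sq_nonneg ((k : ℝ) - 7 / 10)]

theorem gribov_weight_nonneg (k : ℕ) :
    0 ≤ (((k : ℝ) + 1) - 2) * (((k : ℝ) + 1) - 1) * ((k : ℝ) + 1) := by
  rcases k with _ | k
  · simp
  · push_cast
    have : ((k : ℝ) + 1 + 1 - 2) * ((k : ℝ) + 1 + 1 - 1) * ((k : ℝ) + 1 + 1) =
      k * (k + 1) * (k + 2) := by ring
    rw [this]
    positivity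

theorem sqrt_le_interpolation {S g f : ℝ} (hg : 0 ≤ g) (hf : 0 ≤ f)
    (hS : S ≤ 70 * (g * f) + 112 * f ^ 2) :
    √S ≤ (1 + 2 * √2) * √5 * g ^ ((1 : ℝ) / 2) * f ^ ((1 : ℝ) / 2) +
      (1 + 2 * √2) * (65 : ℝ) ^ ((1 : ℝ) / 4) * f := by
  have hr : (8 : ℝ) ≤ ((65 : ℝ) ^ ((1 : ℝ) / 4)) ^ 2 := by
    rw [← Real.rpow_natCast, ← Real.rpow_mul (by norm_num)]
    norm_num
    rw [← Real.sqrt_eq_rpow]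
    exact Real.le_sqrt_of_sq_le (by norm_num)
  have hr0 : 0 ≤ (65 : ℝ) ^ ((1 : ℝ) / 4) := by positivity
  generalize (65 : ℝ) ^ ((1 : ℝ) / 4) = r at hr hr0 ⊢
  rw [← Real.sqrt_eq_rpow, ← Real.sqrt_eq_rpow]
  refine Real.sqrt_le_iff.2 ⟨by positivity, hS.trans ?_⟩
  have h2 : (14 : ℝ) ≤ (1 + 2 * √2) ^ 2 := by
    have : (1.4 : ℝ) ≤ √2 := Real.le_sqrt_of_sq_le (by norm_num)
    nlinarith
  have hgf : 0 ≤ g * f := mul_nonneg hg hf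
  calc 70 * (g * f) + 112 * f ^ 2 = 14 * (5 * (g * f) + 8 * f ^ 2) := by ring
    _ ≤ (1 + 2 * √2) ^ 2 * (5 * (g * f) + r ^ 2 * f ^ 2) := by gcongr
    _ = (1 + 2 * √2) ^ 2 * ((√5 * √g * √f) ^ 2 + (r * f) ^ 2) := by
      simp only [mul_pow, Real.sq_sqrt hg, Real.sq_sqrt hf,
        Real.sq_sqrt (show (0 : ℝ) ≤ 5 by norm_num)]
      ring
    _ ≤ (1 + 2 * √2) ^ 2 * (√5 * √g * √f + r * f) ^ 2 := by
      gcongr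
      have : 0 ≤ (√5 * √g * √f) * (r * f) := by positivity
      linarith [add_sq (√5 * √g * √f) (r * f)]
    _ = _ := by ring


/-- Final chained inequality of Lemma 3.2(iv):
`‖H₁φ‖ ≤ (1+2√2)√5 ‖Gφ‖^{1/2} ‖φ‖^{1/2} + (1+2√2)·65^{1/4} ‖φ‖`,
expressed via the coefficient sequence `a k = ⟨φ, e k⟩`,
where `g = ‖Gφ‖` and `f = ‖φ‖`. -/
theorem coeff_H1_le_G (a : ℕ → ℂ) (c : ℕ → ℂ) (ha0 : a 0 = 0)
    (hg : Summable fun k : ℕ =>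
      ((((k : ℝ) + 1) - 2) * (((k : ℝ) + 1) - 1) * ((k : ℝ) + 1)) ^ 2 * ‖a (k + 1)‖ ^ 2)
    (hf : Summable fun k : ℕ => ‖a (k + 1)‖ ^ 2)
    (hc : ∀ m : ℕ, 1 ≤ m →
      c m = ((((m : ℝ) - 1) * Real.sqrt (m : ℝ) : ℝ) : ℂ) * a (m - 1)
          + (((m : ℝ) * Real.sqrt ((m : ℝ) + 1) : ℝ) : ℂ) * a (m + 1)) :
    (Summable fun m : ℕ => ‖c (m + 1)‖ ^ 2) ∧
      Real.sqrt (∑' m : ℕ, ‖c (m + 1)‖ ^ 2) ≤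
        (1 + 2 * Real.sqrt 2) * Real.sqrt 5 *
            (Real.sqrt (∑' k : ℕ,
              ((((k : ℝ) + 1) - 2) * (((k : ℝ) + 1) - 1) * ((k : ℝ) + 1)) ^ 2
                * ‖a (k + 1)‖ ^ 2)) ^ ((1 : ℝ) / 2) *
            (Real.sqrt (∑' k : ℕ, ‖a (k + 1)‖ ^ 2)) ^ ((1 : ℝ) / 2)
          + (1 + 2 * Real.sqrt 2) * (65 : ℝ) ^ ((1 : ℝ) / 4) *
              Real.sqrt (∑' k : ℕ, ‖a (k + 1)‖ ^ 2) := by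
 
  obtain ⟨hG, hGle⟩ := summable_and_tsum_weight_mul_sq_le gribov_weight_nonneg
    (fun k => norm_nonneg (a (k + 1))) hg hf
  have hu_sq (m : ℕ) : ((m + 1 : ℕ) * √((m + 1 : ℕ) + 1) * ‖a (m + 1)‖ : ℝ) ^ 2 =
      ((m : ℝ) + 1) ^ 2 * ((m : ℝ) + 2) * ‖a (m + 1)‖ ^ 2 := by
    rw [mul_pow, mul_pow, Real.sq_sqrt (by positivity)]
    push_cast
    ring
  have hv_sq (m : ℕ) : (m * √((m : ℝ) + 1) * ‖a (m + 1)‖) ^ 2 =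
      (m : ℝ) ^ 2 * ((m : ℝ) + 1) * ‖a (m + 1)‖ ^ 2 := by
    rw [mul_pow, mul_pow, Real.sq_sqrt (by positivity)]
  have hdom := (hG.mul_left 70).add (hf.mul_left 112)
  have hle (m : ℕ) : 2 * (((m : ℝ) + 1) ^ 2 * ((m : ℝ) + 2) * ‖a (m + 1)‖ ^ 2 +
      (m : ℝ) ^ 2 * ((m : ℝ) + 1) * ‖a (m + 1)‖ ^ 2) ≤
      70 * ((((m : ℝ) + 1) - 2) * (((m : ℝ) + 1) - 1) * ((m : ℝ) + 1) * ‖a (m + 1)‖ ^ 2) +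
        112 * ‖a (m + 1)‖ ^ 2 := by
    linarith [mul_le_mul_of_nonneg_right (gribov_weight_le m) (sq_nonneg ‖a (m + 1)‖)]
  have hu : Summable fun m : ℕ => ((m : ℝ) + 1) ^ 2 * ((m : ℝ) + 2) * ‖a (m + 1)‖ ^ 2 := by
    refine hdom.of_nonneg_of_le (fun m => by positivity) fun m => ?_
    have h₁ : 0 ≤ ((m : ℝ) + 1) ^ 2 * ((m : ℝ) + 2) * ‖a (m + 1)‖ ^ 2 := by positivity
    have h₂ : 0 ≤ (m : ℝ) ^ 2 * ((m : ℝ) + 1) * ‖a (m + 1)‖ ^ 2 := by positivity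
    linarith [hle m]
  have hv : Summable fun m : ℕ => (m : ℝ) ^ 2 * ((m : ℝ) + 1) * ‖a (m + 1)‖ ^ 2 := by
    refine hu.of_nonneg_of_le (fun m => by positivity) fun m => ?_
    gcongr <;> linarith
  have hnorm (m : ℕ) : ‖c (m + 1)‖ ≤
      m * √((m : ℝ) + 1) * ‖a m‖ + (m + 1 : ℕ) * √((m + 1 : ℕ) + 1) * ‖a (m + 1 + 1)‖ := by
    rw [hc (m + 1) (by omega)]
    refine (norm_add_le _ _).trans_eq ?_
    rw [norm_mul, norm_mul, Complex.norm_of_nonneg, Complex.norm_of_nonneg (by positivity)]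
    · simp
    · push_cast
      rw [add_sub_cancel_right]
      positivity
  obtain ⟨hsum, hS⟩ := summable_and_tsum_sq_le_of_le_shift
    (u := fun m => m * √((m : ℝ) + 1) * ‖a m‖) (v := fun m => m * √((m : ℝ) + 1) * ‖a (m + 1)‖)
    (fun m => norm_nonneg (c (m + 1))) (by simp) (by simp) hnorm
    (by simpa only [hu_sq] using hu) (by simpa only [hv_sq] using hv)
  refine ⟨hsum, sqrt_le_interpolation (Real.sqrt_nonneg _) (Real.sqrt_nonneg _) (hS.trans ?_)⟩
  simp only [hu_sq, hv_sq]
  rw [← hu.tsum_add hv, ← tsum_mul_left, Real.sq_sqrt (tsum_nonneg fun k => sq_nonneg _)]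
  refine (((hu.add hv).mul_left 2).tsum_le_tsum hle hdom).trans ?_
  rw [(hG.mul_left 70).tsum_add (hf.mul_left 112), tsum_mul_left, tsum_mul_left]
  gcongr
end

section
/- Let H be a complex Hilbert space and let T be a linear map defined on a subspace dom T ⊆ H with values in H whose graph {(u, Tu) : u ∈ dom T} is closed in H × H. Let N ≥ 1, let p₁,…,p_N ∈ [0,1] and b₁,…,b_N ≥ 0 with Σ_{k=1}^N b_k p_k < 1, and let R : dom T → H be a linear map such that ‖Ru‖ ≤ Σ_{k=1}^N b_k ‖Tu‖^{p_k} ‖u‖^{1−p_k} for all u ∈ dom T (with the convention 0⁰ = 1). Then the operator u ↦ Tu + Ru, defined on dom T, also has closed graph. -/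
open Filter Topology in
/-- **Kato's stability theorem for closedness**: a perturbation of a closed operator `T` which is
relatively bounded with relative bound less than one is closed. -/
theorem LinearPMap.IsClosed.add_of_relatively_bounded
    {𝕜 E F : Type*} [NormedField 𝕜] [NormedAddCommGroup E] [NormedSpace 𝕜 E]
    [NormedAddCommGroup F] [NormedSpace 𝕜 F] [CompleteSpace F]
    {T : E →ₗ.[𝕜] F} (hT : T.IsClosed) (R : T.domain →ₗ[𝕜] F)
    {a c : ℝ} (ha : a < 1) (hc : 0 ≤ c)
    (hR : ∀ u : T.domain, ‖R u‖ ≤ a * ‖T u‖ + c * ‖(u : E)‖) :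
    (LinearPMap.mk T.domain (T.toFun + R)).IsClosed := by
  have ha' : 0 < 1 - a := sub_pos.2 ha
  have bound (u : T.domain) : (1 - a) * ‖T u‖ ≤ ‖T u + R u‖ + c * ‖(u : E)‖ := by
    have h := norm_sub_le (T u + R u) (R u)
    rw [add_sub_cancel_right] at h
    linarith [hR u]
  refine IsSeqClosed.isClosed fun f q hf hfq => ?_
  have hu (n : ℕ) : ∃ u : T.domain, (u : E) = (f n).1 ∧ T u + R u = (f n).2 := by
    simpa using (LinearPMap.mem_graph_iff _).1 (hf n)
  choose u hu₁ hu₂ using hu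
  have h₁ : Tendsto (fun n => (u n : E)) atTop (𝓝 q.1) := by
    simpa only [hu₁, Function.comp_def] using (continuous_fst.tendsto q).comp hfq
  have h₂ : Tendsto (fun n => T (u n) + R (u n)) atTop (𝓝 q.2) := by
    simpa only [hu₂, Function.comp_def] using (continuous_snd.tendsto q).comp hfq
  have hcauchy : CauchySeq fun n => T (u n) := by
    rw [Metric.cauchySeq_iff]
    intro ε hε
    have hδ : 0 < (1 - a) * ε / (1 + c) := by positivity
    obtain ⟨N, hN⟩ := Metric.cauchySeq_iff.1 hfq.cauchySeq _ hδ
    refine ⟨N, fun m hm n hn => ?_⟩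
    have hd := hN m hm n hn
    rw [lt_div_iff₀ (by positivity), Prod.dist_eq] at hd
    have hb := bound (u m - u n)
    have h₃ : T (u m - u n) + R (u m - u n) = (f m).2 - (f n).2 := by
      rw [← hu₂, ← hu₂, T.map_sub, R.map_sub]
      abel
    rw [h₃, Submodule.coe_sub, hu₁, hu₁, ← dist_eq_norm, ← dist_eq_norm, T.map_sub,
      ← dist_eq_norm] at hb
    have hmax₁ := mul_le_mul_of_nonneg_left
      (le_max_left (dist (f m).1 (f n).1) (dist (f m).2 (f n).2)) hc
    have hmax₂ := le_max_right (dist (f m).1 (f n).1) (dist (f m).2 (f n).2)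
    refine lt_of_mul_lt_mul_left ?_ ha'.le
    linarith
  obtain ⟨z, hz⟩ := cauchySeq_tendsto_of_complete hcauchy
  have hmem : (q.1, z) ∈ (T.graph : Set (E × F)) :=
    _root_.IsClosed.mem_of_tendsto hT (h₁.prodMk_nhds hz) (Eventually.of_forall fun n => T.mem_graph (u n))
  obtain ⟨x, hx, hxz⟩ := (LinearPMap.mem_graph_iff _).1 hmem
  dsimp only at hx hxz
  have hRlim : Tendsto (fun n => R (u n)) atTop (𝓝 (R x)) := by
    rw [tendsto_iff_norm_sub_tendsto_zero]
    have hlim := ((tendsto_iff_norm_sub_tendsto_zero.1 hz).const_mul a).add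
      ((tendsto_iff_norm_sub_tendsto_zero.1 h₁).const_mul c)
    rw [mul_zero, mul_zero, add_zero] at hlim
    refine squeeze_zero (fun _ => norm_nonneg _) (fun n => ?_) hlim
    have h := hR (u n - x)
    rwa [R.map_sub, T.map_sub, Submodule.coe_sub, hx, hxz] at h
  have hq : z + R x = q.2 := tendsto_nhds_unique (hz.add hRlim) h₂
  refine (LinearPMap.mem_graph_iff _).2 ⟨x, hx, ?_⟩
  rw [← hq, ← hxz]
  rfl

/-- Abstract closedness principle behind Proposition 3.7: if `T` is a closed
(unbounded) operator on a Hilbert space `H` and `R` is a generalized subordinate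
perturbation of `T` with `∑ b_k p_k < 1`, then `T + R` (on the domain of `T`)
is closed. -/
theorem closed_of_generalized_subordinate
    {H : Type*} [NormedAddCommGroup H] [InnerProductSpace ℂ H] [CompleteSpace H]
    (T : H →ₗ.[ℂ] H) (hT : IsClosed (T.graph : Set (H × H)))
    (N : ℕ) (hN : 1 ≤ N) (p b : Fin N → ℝ)
    (hp : ∀ k, p k ∈ Set.Icc (0 : ℝ) 1) (hb : ∀ k, 0 ≤ b k)
    (hbp : ∑ k, b k * p k < 1)
    (R : T.domain →ₗ[ℂ] H)
    (hR : ∀ u : T.domain, ‖R u‖ ≤ ∑ k, b k * ‖T u‖ ^ (p k) * ‖(u : H)‖ ^ (1 - p k)) :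
    IsClosed ((LinearPMap.mk T.domain (T.toFun + R)).graph : Set (H × H)) := by
  refine LinearPMap.IsClosed.add_of_relatively_bounded hT R hbp
    (c := ∑ k, b k * (1 - p k))
    (Finset.sum_nonneg fun k _ => mul_nonneg (hb k) (sub_nonneg.2 (hp k).2)) fun u => ?_
  refine (hR u).trans ?_
  rw [Finset.sum_mul, Finset.sum_mul, ← Finset.sum_add_distrib]
  refine Finset.sum_le_sum fun k _ => ?_
  have h := Real.geom_mean_le_arith_mean2_weighted (hp k).1 (sub_nonneg.2 (hp k).2)
    (norm_nonneg (T u)) (norm_nonneg (u : H)) (add_sub_cancel _ _)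
  calc b k * ‖T u‖ ^ p k * ‖(u : H)‖ ^ (1 - p k)
      = b k * (‖T u‖ ^ p k * ‖(u : H)‖ ^ (1 - p k)) := mul_assoc _ _ _
    _ ≤ b k * (p k * ‖T u‖ + (1 - p k) * ‖(u : H)‖) := mul_le_mul_of_nonneg_left h (hb k)
    _ = b k * p k * ‖T u‖ + b k * (1 - p k) * ‖(u : H)‖ := by ring
end

section
/- Let n ≥ 2 be a natural number, let a ≥ 7/5 and 0 < γ < 1 be real numbers, and define, for (i,j) ∈ Ω_n := {(i,j) ∈ {1,…,n}² : i ≠ j}, the exponents p_{12} = p_{21} = 1/3 and p_{ij} = a^{−(i+j)} for all other (i,j) ∈ Ω_n. Then Σ_{(i,j) ∈ Ω_n} γ^{p_{ij}} · p_{ij}² < 1. -/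
theorem sum_Icc_one_pow_le {r : ℝ} (h0 : 0 ≤ r) (h1 : r < 1) (n : ℕ) :
    ∑ i ∈ Finset.Icc 1 n, r ^ i ≤ r / (1 - r) := by
  have h := Finset.sum_le_sum_of_subset_of_nonneg (f := fun i => r ^ i)
    (Finset.Icc_subset_Ico_right (a := 1) n.lt_succ_self) (fun i _ _ => pow_nonneg h0 i)
  refine h.trans ?_
  simpa using geom_sum_Ico_le_of_lt_one (m := 1) (n := n + 1) h0 h1

theorem zpow_neg_add_sq_le {a : ℝ} (ha : 7 / 5 ≤ a) (i j : ℕ) :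
    (a ^ (-((i : ℤ) + (j : ℤ)))) ^ 2 ≤ (25 / 49 : ℝ) ^ i * (25 / 49 : ℝ) ^ j := by
  have h0 : 0 < a := by linarith
  have hinv : a⁻¹ ≤ 5 / 7 := (inv_anti₀ (by norm_num) ha).trans_eq (by norm_num)
  have heq : (a ^ (-((i : ℤ) + (j : ℤ)))) ^ 2 = (a⁻¹ ^ 2) ^ (i + j) := by
    rw [zpow_neg, ← Nat.cast_add, zpow_natCast, ← inv_pow, ← pow_mul, ← pow_mul, mul_comm]
  rw [heq, ← pow_add]
  have hsq : a⁻¹ ^ 2 ≤ 25 / 49 :=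
    (pow_le_pow_left₀ (inv_nonneg.2 h0.le) hinv 2).trans_eq (by norm_num)
  exact pow_le_pow_left₀ (sq_nonneg _) hsq _

/-- The quantitative inequality of Proposition 3.12: with `p 1 2 = p 2 1 = 1/3`
and `p i j = a^{-(i+j)}` for the other pairs `(i,j) ∈ Ω_n`, `a ≥ 7/5` and
`0 < γ < 1`, one has `Σ_{(i,j) ∈ Ω_n} γ^{p i j} · (p i j)² < 1`. -/
theorem gribov_example_sum_lt_one (n : ℕ) (hn : 2 ≤ n) (a γ : ℝ)
    (ha : 7 / 5 ≤ a) (hγ0 : 0 < γ) (hγ1 : γ < 1)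
    (p : ℕ → ℕ → ℝ)
    (hp12 : p 1 2 = 1 / 3) (hp21 : p 2 1 = 1 / 3)
    (hp : ∀ i j : ℕ, 1 ≤ i → i ≤ n → 1 ≤ j → j ≤ n → i ≠ j →
      (i, j) ≠ (1, 2) → (i, j) ≠ (2, 1) → p i j = a ^ (-((i : ℤ) + (j : ℤ)))) :
    ∑ i ∈ Finset.Icc 1 n, ∑ j ∈ (Finset.Icc 1 n).filter (fun j => j ≠ i),
        γ ^ (p i j) * (p i j) ^ 2 < 1 := by
  have hterm : ∀ q : ℝ, 0 ≤ q → γ ^ q * q ^ 2 ≤ q ^ 2 := fun q hq =>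
    mul_le_of_le_one_left (sq_nonneg q) (Real.rpow_le_one hγ0.le hγ1.le hq)
  -- Termwise majorant: a product of geometric terms, corrected at `(1,1)`, `(1,2)` and `(2,1)`.
  have hbound : ∀ i ∈ Finset.Icc 1 n, ∀ j ∈ Finset.Icc 1 n,
      (if j ≠ i then γ ^ (p i j) * (p i j) ^ 2 else 0) ≤
        (25 / 49 : ℝ) ^ i * (25 / 49 : ℝ) ^ j
          + ((if i = 1 then if j = 1 then -(25 / 49 : ℝ) ^ 2 else 0 else 0)
          + (if i = 1 then if j = 2 then 1 / 9 - (25 / 49 : ℝ) ^ 3 else 0 else 0)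
          + (if i = 2 then if j = 1 then 1 / 9 - (25 / 49 : ℝ) ^ 3 else 0 else 0)) := by
    intro i hi j hj
    rw [Finset.mem_Icc] at hi hj
    have h3 := hterm (1 / 3) (by norm_num)
    by_cases h12 : i = 1 ∧ j = 2
    · obtain ⟨rfl, rfl⟩ := h12
      rw [hp12]
      norm_num at h3 ⊢
      exact h3
    by_cases h21 : i = 2 ∧ j = 1
    · obtain ⟨rfl, rfl⟩ := h21
      rw [hp21]
      norm_num at h3 ⊢
      exact h3
    by_cases h11 : i = 1 ∧ j = 1
    · obtain ⟨rfl, rfl⟩ := h11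
      norm_num
    simp only [← ite_and, if_neg h12, if_neg h21, if_neg h11, add_zero]
    split_ifs with hij
    · rw [hp i j hi.1 hi.2 hj.1 hj.2 hij.symm (by simpa using h12) (by simpa using h21)]
      exact (hterm _ (zpow_nonneg (by linarith) _)).trans (zpow_neg_add_sq_le ha i j)
    · positivity
  simp only [Finset.sum_filter]
  refine (Finset.sum_le_sum fun i hi => Finset.sum_le_sum (hbound i hi)).trans_lt ?_
  have hS : ∑ i ∈ Finset.Icc 1 n, (25 / 49 : ℝ) ^ i ≤ 25 / 24 :=
    (sum_Icc_one_pow_le (by norm_num) (by norm_num) n).trans_eq (by norm_num)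
  have hS0 : 0 ≤ ∑ i ∈ Finset.Icc 1 n, (25 / 49 : ℝ) ^ i :=
    Finset.sum_nonneg fun i _ => by positivity
  have h1 : 1 ∈ Finset.Icc 1 n := Finset.mem_Icc.2 ⟨le_rfl, by omega⟩
  have h2 : 2 ∈ Finset.Icc 1 n := Finset.mem_Icc.2 ⟨by omega, hn⟩
  have hcorner : ∀ k ∈ Finset.Icc 1 n, ∀ l ∈ Finset.Icc 1 n, ∀ c : ℝ,
      ∑ i ∈ Finset.Icc 1 n, ∑ j ∈ Finset.Icc 1 n,
        (if i = k then if j = l then c else 0 else 0) = c := by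
    intro k hk l hl c
    rw [Finset.sum_eq_single_of_mem k hk fun i _ hik => by simp [hik],
      Finset.sum_eq_single_of_mem l hl fun j _ hjl => by simp [hjl]]
    simp
  simp only [Finset.sum_add_distrib, ← Finset.sum_mul_sum]
  rw [hcorner 1 h1 1 h1, hcorner 1 h1 2 h2, hcorner 2 h2 1 h1]
  have hSS := mul_le_mul hS hS hS0 (by norm_num)
  norm_num at hSS ⊢
  linarith
end
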